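/- Let f : ℂ^n → ℂ be an entire holomorphic function that is strongly elliptic. Then for every integer k ≥ 0 there exist constants C > 0 and R > 0 such that ∇f(z) ≠ 0 whenever ‖z‖ ≥ R, and for all z with ‖z‖ ≥ R, ‖D^k h(z)‖ ≤ C (‖∇f(z)‖^{k+2} + 1), where h(z) := ‖∇f(z)‖^{-2}. -/

import Mathlib

open scoped BigOperators

/-- The norm of the holomorphic gradient `∇f(z) = (∂f/∂z_1, …, ∂f/∂z_n)`,
namely `(Σ_i |∂f/∂z_i(z)|²)^{1/2}`. -/
noncomputable def gradNorm (n : ℕ) (f : EuclideanSpace ℂ (Fin n) → ℂ)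
    (z : EuclideanSpace ℂ (Fin n)) : ℝ :=
  Real.sqrt (∑ i : Fin n, ‖fderiv ℂ f z (EuclideanSpace.single i 1)‖ ^ 2)

open Metric in
/-- Cauchy's estimate for the Fréchet derivative of an entire function. -/
theorem Differentiable.norm_fderiv_le_of_forall_closedBall {E : Type*} [NormedAddCommGroup E]
    [NormedSpace ℂ E] {f : E → ℂ} (hf : Differentiable ℂ f) {w : E} {M : ℝ}
    (hM : ∀ x ∈ closedBall w 1, ‖f x‖ ≤ M) : ‖fderiv ℂ f w‖ ≤ M := by
  have hM0 : 0 ≤ M := (norm_nonneg _).trans (hM w (by simp))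
  refine ContinuousLinearMap.opNorm_le_of_unit_norm (𝕜 := ℂ) hM0 fun v hv => ?_
  have hd : HasDerivAt (fun t : ℂ => f (w + t • v)) (fderiv ℂ f w v) 0 := by
    have h1 : HasDerivAt (fun t : ℂ => w + t • v) v 0 := by
      simpa using ((hasDerivAt_id (0 : ℂ)).smul_const v).const_add w
    have h2 : HasFDerivAt f (fderiv ℂ f w) (w + (0 : ℂ) • v) := by
      simpa using (hf w).hasFDerivAt
    exact h2.comp_hasDerivAt 0 h1
  have hD : Differentiable ℂ (fun t : ℂ => f (w + t • v)) := by fun_prop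
  rw [← hd.deriv]
  simpa using Complex.norm_deriv_le_of_forall_mem_sphere_norm_le one_pos hD.diffContOnCl
    (C := M) fun t ht => hM _ (by simp_all [norm_smul])

/-- Cauchy's formula for directional derivatives of an entire function. -/
theorem Differentiable.fderiv_apply_eq_intervalIntegral {E : Type*} [NormedAddCommGroup E]
    [NormedSpace ℂ E] {f : E → ℂ} (hf : Differentiable ℂ f) (y x : E) :
    fderiv ℂ f x y = (2 * Real.pi * Complex.I : ℂ)⁻¹ • ∫ θ in (0 : ℝ)..2 * Real.pi,
      (_root_.deriv (circleMap 0 1) θ * ((circleMap 0 1 θ) ^ 2)⁻¹) • f (x + circleMap 0 1 θ • y) := by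
  have hd : HasDerivAt (fun t : ℂ => f (x + t • y)) (fderiv ℂ f x y) 0 := by
    have h1 : HasDerivAt (fun t : ℂ => x + t • y) y 0 := by
      simpa using ((hasDerivAt_id (0 : ℂ)).smul_const y).const_add x
    have h2 : HasFDerivAt f (fderiv ℂ f x) (x + (0 : ℂ) • y) := by
      simpa using (hf x).hasFDerivAt
    exact h2.comp_hasDerivAt 0 h1
  have hD : Differentiable ℂ (fun t : ℂ => f (x + t • y)) := by fun_prop
  have := Complex.cderiv_eq_deriv (z := 0) (r := 1) isOpen_univ hD.differentiableOn one_pos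
    (Set.subset_univ _)
  rw [← hd.deriv, ← this, Complex.cderiv, circleIntegral]
  simp only [sub_zero, smul_eq_mul, mul_assoc]

open Metric MeasureTheory in
/-- Directional derivatives of an entire function are entire. -/
theorem Differentiable.fderiv_apply {E : Type*} [NormedAddCommGroup E]
    [NormedSpace ℂ E] [FiniteDimensional ℂ E] {f : E → ℂ} (hf : Differentiable ℂ f) (y : E) :
    Differentiable ℂ fun x => fderiv ℂ f x y := by
  intro x₀
  have : ProperSpace E := FiniteDimensional.proper ℂ E
  have : ProperSpace (E →L[ℂ] ℂ) := FiniteDimensional.proper ℂ _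
  borelize E
  obtain ⟨M, hM⟩ := (isCompact_closedBall x₀ (‖y‖ + 2)).exists_bound_of_continuousOn
    hf.continuous.continuousOn
  simp only [hf.fderiv_apply_eq_intervalIntegral y]
  have hk : Continuous fun θ : ℝ => _root_.deriv (circleMap 0 1) θ * ((circleMap 0 1 θ) ^ 2)⁻¹ := by
    simp only [deriv_circleMap]
    exact ((continuous_circleMap 0 1).mul continuous_const).mul
      (((continuous_circleMap 0 1).pow 2).inv₀ fun θ =>
        pow_ne_zero 2 (circleMap_ne_center one_ne_zero))
  have hc : ∀ x : E, Continuous fun θ : ℝ => x + circleMap 0 1 θ • y := fun x =>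
    continuous_const.add ((continuous_circleMap 0 1).smul continuous_const)
  have hF : ∀ x : E, Continuous fun θ : ℝ =>
      (_root_.deriv (circleMap 0 1) θ * ((circleMap 0 1 θ) ^ 2)⁻¹) • f (x + circleMap 0 1 θ • y) :=
    fun x => hk.smul (hf.continuous.comp (hc x))
  apply DifferentiableAt.fun_const_smul
  refine HasFDerivAt.differentiableAt
    (intervalIntegral.hasFDerivAt_integral_of_dominated_of_fderiv_le (μ := volume)
    (bound := fun _ => M)
    (F' := fun x θ => (_root_.deriv (circleMap 0 1) θ * ((circleMap 0 1 θ) ^ 2)⁻¹) •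
      _root_.fderiv ℂ f (x + circleMap 0 1 θ • y)) (ball_mem_nhds x₀ one_pos)
    (Filter.Eventually.of_forall fun x => (hF x).aestronglyMeasurable)
    ((hF x₀).intervalIntegrable _ _) ?_ ?_ intervalIntegrable_const ?_)
  · exact (hk.measurable.smul
      ((measurable_fderiv ℂ f).comp (hc x₀).measurable)).aestronglyMeasurable
  · refine Filter.Eventually.of_forall fun θ _ x hx => ?_
    rw [norm_smul]
    have h1 : ‖_root_.deriv (circleMap 0 1) θ * ((circleMap 0 1 θ) ^ 2)⁻¹‖ = 1 := by simp
    rw [h1, one_mul]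
    refine hf.norm_fderiv_le_of_forall_closedBall fun w hw => hM w ?_
    rw [mem_closedBall, dist_eq_norm] at *
    rw [mem_ball, dist_eq_norm] at hx
    calc ‖w - x₀‖ = ‖(w - (x + circleMap 0 1 θ • y)) + (x - x₀) + circleMap 0 1 θ • y‖ := by
          congr 1; abel
      _ ≤ ‖w - (x + circleMap 0 1 θ • y)‖ + ‖x - x₀‖ + ‖circleMap 0 1 θ • y‖ := norm_add₃_le
      _ ≤ 1 + 1 + ‖y‖ := by
          gcongr
          simp [norm_smul]
      _ = ‖y‖ + 2 := by ring
  · refine Filter.Eventually.of_forall fun θ _ x _ => ?_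
    have h := (hf (x + circleMap 0 1 θ • y)).hasFDerivAt
    exact HasFDerivAt.fun_const_smul ((hasFDerivAt_comp_add_right (circleMap 0 1 θ • y)).2 h)
      (_root_.deriv (circleMap 0 1) θ * ((circleMap 0 1 θ) ^ 2)⁻¹)

/-- An entire function on a finite-dimensional space is smooth. -/
theorem Differentiable.contDiff_of_finiteDimensional {E : Type*} [NormedAddCommGroup E]
    [NormedSpace ℂ E] [FiniteDimensional ℂ E] {f : E → ℂ} (hf : Differentiable ℂ f) (n : ℕ) :
    ContDiff ℂ n f := by
  induction n generalizing f with
  | zero => exact contDiff_zero.2 hf.continuous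
  | succ n ih =>
    push_cast
    exact contDiff_succ_iff_fderiv_apply.2 ⟨hf, by simp, fun y => ih (hf.fderiv_apply y)⟩

/-- Passing to real scalars does not change the norm of iterated derivatives. -/
theorem ContDiffAt.norm_iteratedFDeriv_restrictScalars {E : Type*} [NormedAddCommGroup E]
    [NormedSpace ℂ E] {p : E → ℂ} {m : ℕ} {z : E} (hp : ContDiffAt ℂ m p z) :
    ‖iteratedFDeriv ℝ m p z‖ = ‖iteratedFDeriv ℂ m p z‖ := by
  rw [← hp.restrictScalars_iteratedFDeriv (𝕜 := ℝ)]
  simp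

/-- Geometric bounds on the derivatives of `p` give geometric bounds on those of `‖p‖²`. -/
theorem norm_iteratedFDeriv_norm_sq_le {E F : Type*} [NormedAddCommGroup E] [NormedSpace ℝ E]
    [NormedAddCommGroup F] [InnerProductSpace ℝ F] {p : E → F} {m : ℕ} (hp : ContDiff ℝ m p)
    {z : E} {g : ℝ} (hg : ∀ j ≤ m, ‖iteratedFDeriv ℝ j p z‖ ≤ g ^ (j + 1)) :
    ‖iteratedFDeriv ℝ m (fun x => ‖p x‖ ^ 2) z‖ ≤ 2 ^ m * g ^ (m + 2) := by
  have hB : (fun x => ‖p x‖ ^ 2) = fun x => innerSL ℝ (p x) (p x) := by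
    funext x; simp
  rw [hB]
  calc _ ≤ ∑ i ∈ Finset.range (m + 1), (m.choose i : ℝ) * ‖iteratedFDeriv ℝ i p z‖ *
        ‖iteratedFDeriv ℝ (m - i) p z‖ :=
        (innerSL ℝ).norm_iteratedFDeriv_le_of_bilinear_of_le_one hp hp z le_rfl
          (norm_innerSL_le _)
    _ ≤ ∑ i ∈ Finset.range (m + 1), (m.choose i : ℝ) * g ^ (m + 2) := by
        refine Finset.sum_le_sum fun i hi => ?_
        have him : i ≤ m := by simpa [Nat.lt_succ_iff] using hi
        have e : g ^ (m + 2) = g ^ (i + 1) * g ^ (m - i + 1) := by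
          rw [← pow_add]; congr 1; omega
        rw [e, mul_assoc]
        have h0 := (norm_nonneg _).trans (hg i him)
        gcongr
        · exact hg i him
        · exact hg _ (Nat.sub_le _ _)
    _ = _ := by
        rw [← Finset.sum_mul]
        congr 1
        exact_mod_cast Nat.sum_range_choose m

/-- For each `k`, geometric bounds on the derivatives of `G` relative to `G z = g²` give a bound
on the `k`-th derivative of `1 / G`, with a constant independent of `G`, `z`, `g`. -/
theorem exists_norm_iteratedFDeriv_inv_le (k : ℕ) : ∃ C > (0 : ℝ), ∀ {E : Type*}
    [NormedAddCommGroup E] [NormedSpace ℝ E] {G : E → ℝ} (_ : ContDiff ℝ k G) {z : E} {g A : ℝ}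
    (_ : 0 < g) (_ : G z = g ^ 2)
    (_ : ∀ m, 1 ≤ m → m ≤ k → ‖iteratedFDeriv ℝ m G z‖ ≤ A ^ m * g ^ (m + 2)),
    ‖iteratedFDeriv ℝ k (fun x => (G x)⁻¹) z‖ ≤ C * ((g ^ 2)⁻¹ * (A * g) ^ k) := by
  let c : ℝ := 1 + ∑ i ∈ Finset.range (k + 1),
    ‖iteratedFDerivWithin ℝ i (Inv.inv : ℝ → ℝ) {0}ᶜ 1‖
  have hc : 0 < c := by positivity
  refine ⟨k.factorial * c, by positivity, ?_⟩
  intro E _ _ G hG z g A hg hz hm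
  let u : E → ℝ := fun x => (g ^ 2)⁻¹ • G x
  have hu : ContDiff ℝ k u := hG.const_smul _
  have huz : u z = 1 := by simp [u, hz, hg.ne']
  have hs : IsOpen {x | u x ≠ 0} := isOpen_ne_fun hu.continuous continuous_const
  have hzs : z ∈ {x | u x ≠ 0} := by simp [huz]
  have hinv : ContDiffOn ℝ k (Inv.inv : ℝ → ℝ) {0}ᶜ :=
    fun x hx => (contDiffAt_inv ℝ hx).contDiffWithinAt
  have key := norm_iteratedFDerivWithin_comp_le (x := z) (C := c) (D := A * g) (n := k)
    hinv hu.contDiffOn le_rfl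
    isOpen_compl_singleton.uniqueDiffOn hs.uniqueDiffOn (fun x hx => hx) hzs
    (by
      intro i hi
      rw [huz]
      have := Finset.single_le_sum (f := fun i => ‖iteratedFDerivWithin ℝ i
        (Inv.inv : ℝ → ℝ) {0}ᶜ 1‖) (fun i _ => norm_nonneg _)
        (Finset.mem_range.2 (Nat.lt_succ_of_le hi))
      simp only [c]
      linarith)
    (by
      intro i h1 hi
      rw [iteratedFDerivWithin_of_isOpen i hs hzs, iteratedFDeriv_const_smul_apply'
        (hG.of_le (by exact_mod_cast hi)).contDiffAt, norm_smul, Real.norm_of_nonneg (by positivity)]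
      calc (g ^ 2)⁻¹ * ‖iteratedFDeriv ℝ i G z‖ ≤ (g ^ 2)⁻¹ * (A ^ i * g ^ (i + 2)) := by
            gcongr; exact hm i h1 hi
        _ = (A * g) ^ i := by
            rw [mul_pow, pow_add]
            field_simp)
  rw [iteratedFDerivWithin_of_isOpen k hs hzs] at key
  have hGinv : (fun x => (G x)⁻¹) = fun x => (g ^ 2)⁻¹ • (Inv.inv ∘ u) x := by
    funext x
    simp [u]
    field_simp
  rw [hGinv, iteratedFDeriv_const_smul_apply'
    ((contDiffAt_inv ℝ (by simp [huz])).comp z hu.contDiffAt), norm_smul,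
    Real.norm_of_nonneg (by positivity)]
  calc _ ≤ (g ^ 2)⁻¹ * (k.factorial * c * (A * g) ^ k) := by gcongr
    _ = _ := by ring

/-- if `f` is entire and strongly elliptic, then for every `k` there exist
`C, R > 0` such that `∇f(z) ≠ 0` for `‖z‖ ≥ R` and the real iterated derivatives of
`h(z) = ‖∇f(z)‖⁻²` satisfy `‖D^k h(z)‖ ≤ C (‖∇f(z)‖^{k+2} + 1)` there. -/
theorem stmt9 (n : ℕ) (hn : 0 < n) (f : EuclideanSpace ℂ (Fin n) → ℂ)
    (hf : Differentiable ℂ f)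
    (hse : ∀ ε > (0 : ℝ), ∀ k : ℕ, 2 ≤ k →
      ∀ R > (0 : ℝ), ∃ K > (0 : ℝ), ∀ z : EuclideanSpace ℂ (Fin n),
        K ≤ ‖z‖ → R ≤ ε * (gradNorm n f z) ^ k - ‖iteratedFDeriv ℂ k f z‖) :
    ∀ k : ℕ, ∃ C > (0 : ℝ), ∃ R > (0 : ℝ),
      (∀ z : EuclideanSpace ℂ (Fin n), R ≤ ‖z‖ →
        ∃ i : Fin n, fderiv ℂ f z (EuclideanSpace.single i 1) ≠ 0) ∧
      (∀ z : EuclideanSpace ℂ (Fin n), R ≤ ‖z‖ →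
        ‖iteratedFDeriv ℝ k (fun z => ((gradNorm n f z) ^ 2)⁻¹) z‖
          ≤ C * ((gradNorm n f z) ^ (k + 2) + 1)) := by
  intro k
  have ev : ∀ᶠ z in Bornology.cobounded (EuclideanSpace ℂ (Fin n)), 1 ≤ gradNorm n f z ∧
      ∀ j ∈ Finset.Icc 2 (k + 1), ‖iteratedFDeriv ℂ j f z‖ ≤ gradNorm n f z ^ j := by
    have h : ∀ j, 2 ≤ j → ∀ᶠ z in Bornology.cobounded (EuclideanSpace ℂ (Fin n)),
        1 ≤ 1 * gradNorm n f z ^ j - ‖iteratedFDeriv ℂ j f z‖ := by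
      intro j hj
      obtain ⟨K, -, hK⟩ := hse 1 one_pos j hj 1 one_pos
      filter_upwards [tendsto_norm_cobounded_atTop.eventually_ge_atTop K] with z hz using hK z hz
    refine Filter.Eventually.and ?_ ((Filter.eventually_all_finset _).2 fun j hj => ?_)
    · filter_upwards [h 2 le_rfl] with z hz
      have := norm_nonneg (iteratedFDeriv ℂ 2 f z)
      have h0 : 0 ≤ gradNorm n f z := Real.sqrt_nonneg _
      nlinarith
    · filter_upwards [h j (Finset.mem_Icc.1 hj).1] with z hz
      linarith
  obtain ⟨R, -, hR⟩ := Filter.hasBasis_cobounded_norm.eventually_iff.1 ev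
  have hsq : ∀ z, gradNorm n f z ^ 2 =
      ∑ i : Fin n, ‖fderiv ℂ f z (EuclideanSpace.single i 1)‖ ^ 2 := fun z =>
    Real.sq_sqrt (by positivity)
  obtain ⟨C, hC, hbound⟩ := exists_norm_iteratedFDeriv_inv_le k
  refine ⟨C * (2 * n) ^ k, by positivity, max R 1, by positivity, fun z hz => ?_, fun z hz => ?_⟩
  · by_contra! h0
    have h1 := (hR ((le_max_left _ _).trans hz)).1
    have h2 := hsq z
    simp only [h0, norm_zero] at h2
    norm_num at h2
    linarith
  · obtain ⟨hg1, hj⟩ := hR ((le_max_left _ _).trans hz)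
    set g := gradNorm n f z with hg
    have hp : ∀ i : Fin n, ∀ m : ℕ,
        ContDiff ℂ m fun x => fderiv ℂ f x (EuclideanSpace.single i 1) := fun i m =>
      (hf.fderiv_apply _).contDiff_of_finiteDimensional m
    have hpm : ∀ i : Fin n, ∀ m ≤ k, ‖iteratedFDeriv ℝ m
        (fun x => fderiv ℂ f x (EuclideanSpace.single i 1)) z‖ ≤ g ^ (m + 1) := by
      intro i m hm
      rw [(hp i m).contDiffAt.norm_iteratedFDeriv_restrictScalars]
      rcases Nat.eq_zero_or_pos m with rfl | hm0
      · simp only [norm_iteratedFDeriv_zero, zero_add, pow_one]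
        refine Real.le_sqrt_of_sq_le ?_
        exact Finset.single_le_sum (f := fun i : Fin n =>
          ‖fderiv ℂ f z (EuclideanSpace.single i 1)‖ ^ 2) (fun i _ => by positivity)
          (Finset.mem_univ i)
      · have hfd : ContDiff ℂ m (fderiv ℂ f) :=
          (hf.contDiff_of_finiteDimensional (m + 1)).fderiv_right (by simp)
        calc _ ≤ ‖EuclideanSpace.single i (1 : ℂ)‖ * ‖iteratedFDeriv ℂ m (fderiv ℂ f) z‖ :=
              norm_iteratedFDeriv_clm_apply_const hfd.contDiffAt le_rfl
          _ = ‖iteratedFDeriv ℂ (m + 1) f z‖ := by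
              simp [norm_iteratedFDeriv_fderiv]
          _ ≤ _ := hj _ (Finset.mem_Icc.2 ⟨by omega, by omega⟩)
    have hsm : ∀ i : Fin n, ∀ m : ℕ, ContDiff ℝ m fun x =>
        ‖fderiv ℂ f x (EuclideanSpace.single i 1)‖ ^ 2 := fun i m =>
      ((hp i m).restrict_scalars ℝ).norm_sq ℝ
    have hn1 : (1 : ℝ) ≤ n := by exact_mod_cast hn
    simp only [hsq]
    refine (hbound (g := g) (A := 2 * n) (ContDiff.sum fun i _ => hsm i k) (by linarith)
      (hsq z).symm ?_).trans ?_
    · intro m hm1 hmk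
      rw [iteratedFDeriv_fun_sum_apply fun i _ => (hsm i m).contDiffAt]
      calc _ ≤ ∑ i : Fin n, ‖iteratedFDeriv ℝ m (fun x =>
            ‖fderiv ℂ f x (EuclideanSpace.single i 1)‖ ^ 2) z‖ := norm_sum_le _ _
        _ ≤ ∑ i : Fin n, 2 ^ m * g ^ (m + 2) := Finset.sum_le_sum fun i _ =>
            norm_iteratedFDeriv_norm_sq_le ((hp i m).restrict_scalars ℝ)
              fun j hjm => hpm i j (hjm.trans hmk)
        _ = n * 2 ^ m * g ^ (m + 2) := by simp [mul_assoc]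
        _ ≤ n ^ m * 2 ^ m * g ^ (m + 2) := by
            gcongr
            exact le_self_pow₀ hn1 (by omega)
        _ = _ := by ring
    · have h1 : (g ^ 2)⁻¹ ≤ 1 := inv_le_one_of_one_le₀ (one_le_pow₀ hg1)
      have h2 : g ^ k ≤ g ^ (k + 2) := pow_le_pow_right₀ hg1 (by omega)
      rw [mul_pow, mul_assoc C]
      refine mul_le_mul_of_nonneg_left ?_ hC.le
      calc (g ^ 2)⁻¹ * ((2 * n) ^ k * g ^ k) ≤ 1 * ((2 * n) ^ k * g ^ k) := by gcongr
        _ = (2 * n) ^ k * g ^ k := one_mul _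
        _ ≤ (2 * n) ^ k * (g ^ (k + 2) + 1) := by gcongr; linarith
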